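/- arXiv:1305.0924 — 2 statements merged into one kernel-verified Lean document; each statement's English description precedes it below -/
import Mathlib

section
/- Let p, q > 0. The Cauchy transform of the beta prime distribution satisfies, for every z in the upper half-plane ℂ⁺, the first-order differential equation G̃'_{β'_{p,q}}(z) = ((p−1)/z − (p+q)/(z+1))·G̃_{β'_{p,q}}(z) + q/(z(z+1)); in particular the map z ↦ G̃_{β'_{p,q}}(z) is complex-differentiable on ℂ⁺ with this derivative. -/
open MeasureTheory Complex Set

/-- The Cauchy transform `∫ 1/(z-x) dμ(x)` of a measure on ℝ. -/
noncomputable def cauchyT (μ : Measure ℝ) (z : ℂ) : ℂ := ∫ x, (z - (x : ℂ))⁻¹ ∂μ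

/-- The Euler beta function `B(p,q) = ∫₀¹ x^(p-1) (1-x)^(q-1) dx`. -/
noncomputable def betaFun (p q : ℝ) : ℝ := ∫ x in Ioo (0:ℝ) 1, x ^ (p - 1) * (1 - x) ^ (q - 1)

/-- The beta prime distribution `β'_{p,q}` on `[0,∞)`. -/
noncomputable def betaPrimeMeasure (p q : ℝ) : Measure ℝ :=
  volume.withDensity fun x =>
    ENNReal.ofReal ((Ioi (0:ℝ)).indicator
      (fun x => x ^ (p - 1) * (1 + x) ^ (-(p + q)) / betaFun p q) x)

open Filter Topology

lemma im_le_norm_sub_ofReal (z : ℂ) (x : ℝ) : z.im ≤ ‖z - (x : ℂ)‖ := by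
  have h := Complex.abs_im_le_norm (z - (x : ℂ))
  simp only [sub_im, ofReal_im, sub_zero] at h
  exact (le_abs_self _).trans h

lemma sub_ofReal_ne_zero {z : ℂ} (hz : 0 < z.im) (x : ℝ) : z - (x : ℂ) ≠ 0 :=
  norm_pos_iff.1 (hz.trans_le (im_le_norm_sub_ofReal z x))

lemma norm_inv_sub_ofReal_le {z : ℂ} (hz : 0 < z.im) (x : ℝ) :
    ‖(z - (x : ℂ))⁻¹‖ ≤ z.im⁻¹ := by
  rw [norm_inv]
  exact inv_anti₀ hz (im_le_norm_sub_ofReal z x)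

lemma integrable_inv_sub_ofReal_pow (μ : Measure ℝ) [IsFiniteMeasure μ] {z : ℂ}
    (hz : 0 < z.im) (n : ℕ) : Integrable (fun x : ℝ => ((z - (x : ℂ))⁻¹) ^ n) μ := by
  refine Integrable.of_bound (C := (z.im⁻¹) ^ n) (by fun_prop) (ae_of_all _ fun x => ?_)
  rw [norm_pow]
  exact pow_le_pow_left₀ (norm_nonneg _) (norm_inv_sub_ofReal_le hz x) n

/-- The Cauchy transform of a finite measure may be differentiated under the integral sign. -/
lemma hasDerivAt_cauchyT (μ : Measure ℝ) [IsFiniteMeasure μ] {z : ℂ} (hz : 0 < z.im) :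
    HasDerivAt (cauchyT μ) (∫ x, -((z - (x : ℂ))⁻¹) ^ 2 ∂μ) z := by
  have hs : {w : ℂ | z.im / 2 < w.im} ∈ 𝓝 z :=
    (isOpen_lt continuous_const Complex.continuous_im).mem_nhds (half_lt_self hz)
  refine (hasDerivAt_integral_of_dominated_loc_of_deriv_le
    (F := fun w (x : ℝ) => (w - (x : ℂ))⁻¹) (F' := fun w (x : ℝ) => -((w - (x : ℂ))⁻¹) ^ 2)
    (bound := fun _ => ((z.im / 2)⁻¹) ^ 2) hs
    (Eventually.of_forall fun w => by fun_prop) ?_ (by fun_prop) ?_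
    (integrable_const _) ?_).2
  · simpa using integrable_inv_sub_ofReal_pow μ hz 1
  · refine ae_of_all _ fun x w hw => ?_
    have hw' : z.im / 2 < w.im := hw
    rw [norm_neg, norm_pow]
    exact pow_le_pow_left₀ (norm_nonneg _) ((norm_inv_sub_ofReal_le
      ((half_pos hz).trans hw') x).trans (inv_anti₀ (half_pos hz) hw'.le)) 2
  · refine ae_of_all _ fun x w hw => ?_
    have hw' : z.im / 2 < w.im := hw
    convert! ((hasDerivAt_id w).sub_const (x : ℂ)).inv
      (sub_ofReal_ne_zero ((half_pos hz).trans hw') x) using 1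
    simp [neg_div]

lemma integrableOn_beta {p q : ℝ} (hp : 0 < p) (hq : 0 < q) :
    IntegrableOn (fun x : ℝ => x ^ (p - 1) * (1 - x) ^ (q - 1)) (Ioo 0 1) := by
  have h := Complex.betaIntegral_convergent (u := p) (v := q) (by simpa) (by simpa)
  rw [intervalIntegrable_iff_integrableOn_Ioo_of_le zero_le_one] at h
  refine IntegrableOn.congr_fun (Integrable.norm h) (fun x hx => ?_) measurableSet_Ioo
  have h1 : (0 : ℝ) < 1 - x := by linarith [hx.2]
  have e : (1 : ℂ) - x = ((1 - x : ℝ) : ℂ) := by push_cast; rfl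
  simp only [norm_mul, e]
  rw [Complex.norm_cpow_eq_rpow_re_of_pos hx.1, Complex.norm_cpow_eq_rpow_re_of_pos h1]
  simp

lemma betaFun_pos {p q : ℝ} (hp : 0 < p) (hq : 0 < q) : 0 < betaFun p q := by
  have hpos : ∀ x ∈ Ioo (0 : ℝ) 1, 0 < x ^ (p - 1) * (1 - x) ^ (q - 1) := fun x hx =>
    mul_pos (Real.rpow_pos_of_pos hx.1 _) (Real.rpow_pos_of_pos (by linarith [hx.2]) _)
  refine (setIntegral_pos_iff_support_of_nonneg_ae
    (ae_restrict_of_forall_mem measurableSet_Ioo fun x hx => (hpos x hx).le)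
    (integrableOn_beta hp hq)).2 ?_
  rw [inter_eq_right.2 fun x hx => Function.mem_support.2 (hpos x hx).ne']
  simp

lemma image_div_one_sub_Ioo : (fun t : ℝ => t / (1 - t)) '' Ioo 0 1 = Ioi 0 := by
  ext x
  constructor
  · rintro ⟨t, ht, rfl⟩
    exact div_pos ht.1 (by linarith [ht.2])
  · intro hx
    have hx' : 0 < x := hx
    refine ⟨x / (1 + x), ⟨by positivity, (div_lt_one (by positivity)).2 (by linarith)⟩, ?_⟩
    have : 1 + x ≠ 0 := by positivity
    field_simp
    ring

lemma injOn_div_one_sub_Ioo : InjOn (fun t : ℝ => t / (1 - t)) (Ioo 0 1) := by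
  intro s hs t ht h
  have h1 : 1 - s ≠ 0 := by linarith [hs.2]
  have h2 : 1 - t ≠ 0 := by linarith [ht.2]
  simp only [div_eq_div_iff h1 h2] at h
  linarith

lemma hasDerivWithinAt_div_one_sub {t : ℝ} (ht : t ∈ Ioo (0 : ℝ) 1) :
    HasDerivWithinAt (fun t : ℝ => t / (1 - t)) (1 / (1 - t) ^ 2) (Ioo 0 1) t := by
  have h1 : 1 - t ≠ 0 := by linarith [ht.2]
  have h := (hasDerivAt_id t).div ((hasDerivAt_id t).const_sub 1) h1
  convert! h.hasDerivWithinAt using 1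
  simp

lemma abs_deriv_smul_betaPrime (p q : ℝ) {t : ℝ} (ht : t ∈ Ioo (0 : ℝ) 1) :
    |1 / (1 - t) ^ 2| • ((t / (1 - t)) ^ (p - 1) * (1 + t / (1 - t)) ^ (-(p + q)))
      = t ^ (p - 1) * (1 - t) ^ (q - 1) := by
  have h1 : 0 < 1 - t := by linarith [ht.2]
  have e : 1 + t / (1 - t) = (1 - t)⁻¹ := by field_simp; ring
  rw [e, abs_of_nonneg (by positivity), Real.div_rpow ht.1.le h1.le, Real.inv_rpow h1.le,
    Real.rpow_neg h1.le, inv_inv, smul_eq_mul]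
  have h2 : (1 - t) ^ (p + q) = (1 - t) ^ (q - 1) * (1 - t) ^ (p - 1) * (1 - t) ^ 2 := by
    rw [← Real.rpow_natCast, ← Real.rpow_add h1, ← Real.rpow_add h1]
    congr 1
    push_cast
    ring
  have h3 := (Real.rpow_pos_of_pos h1 (p - 1)).ne'
  rw [h2]
  field_simp

lemma integrableOn_betaPrime {p q : ℝ} (hp : 0 < p) (hq : 0 < q) :
    IntegrableOn (fun x : ℝ => x ^ (p - 1) * (1 + x) ^ (-(p + q))) (Ioi 0) := by
  rw [← image_div_one_sub_Ioo, integrableOn_image_iff_integrableOn_abs_deriv_smul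
    measurableSet_Ioo (fun t ht => hasDerivWithinAt_div_one_sub ht) injOn_div_one_sub_Ioo]
  exact (integrableOn_beta hp hq).congr_fun
    (fun t ht => (abs_deriv_smul_betaPrime p q ht).symm) measurableSet_Ioo

lemma integral_betaPrime (p q : ℝ) :
    ∫ x in Ioi (0 : ℝ), x ^ (p - 1) * (1 + x) ^ (-(p + q)) = betaFun p q := by
  rw [← image_div_one_sub_Ioo, integral_image_eq_integral_abs_deriv_smul
    measurableSet_Ioo (fun t ht => hasDerivWithinAt_div_one_sub ht) injOn_div_one_sub_Ioo]
  exact setIntegral_congr_fun measurableSet_Ioo fun t ht => abs_deriv_smul_betaPrime p q ht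

lemma betaPrimeMeasure_eq_withDensity_restrict (p q : ℝ) :
    betaPrimeMeasure p q = (volume.restrict (Ioi 0)).withDensity fun x =>
      ENNReal.ofReal (x ^ (p - 1) * (1 + x) ^ (-(p + q)) / betaFun p q) := by
  rw [← withDensity_indicator measurableSet_Ioi, betaPrimeMeasure]
  congr 1
  ext x
  by_cases hx : x ∈ Ioi (0 : ℝ) <;> simp [hx]

lemma betaPrime_nonneg {p q : ℝ} (hp : 0 < p) (hq : 0 < q) {x : ℝ} (hx : x ∈ Ioi (0 : ℝ)) :
    0 ≤ x ^ (p - 1) * (1 + x) ^ (-(p + q)) / betaFun p q := by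
  have hx' : 0 < x := hx
  have := betaFun_pos hp hq
  positivity

lemma isProbabilityMeasure_betaPrimeMeasure {p q : ℝ} (hp : 0 < p) (hq : 0 < q) :
    IsProbabilityMeasure (betaPrimeMeasure p q) := by
  rw [isProbabilityMeasure_iff, betaPrimeMeasure_eq_withDensity_restrict,
    withDensity_apply _ MeasurableSet.univ, Measure.restrict_univ,
    ← ofReal_integral_eq_lintegral_ofReal ((integrableOn_betaPrime hp hq).div_const _)
      (ae_restrict_of_forall_mem measurableSet_Ioi fun x hx => betaPrime_nonneg hp hq hx),
    integral_div, integral_betaPrime, div_self (betaFun_pos hp hq).ne', ENNReal.ofReal_one]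

lemma integral_betaPrimeMeasure {p q : ℝ} (hp : 0 < p) (hq : 0 < q) (f : ℝ → ℂ) :
    ∫ x, f x ∂betaPrimeMeasure p q =
      ∫ x in Ioi (0 : ℝ), (x ^ (p - 1) * (1 + x) ^ (-(p + q)) / betaFun p q) • f x := by
  rw [betaPrimeMeasure_eq_withDensity_restrict, integral_withDensity_eq_integral_toReal_smul
    (by fun_prop) (ae_of_all _ fun x => ENNReal.ofReal_lt_top)]
  refine setIntegral_congr_fun measurableSet_Ioi fun x hx => ?_
  simp only [ENNReal.toReal_ofReal (betaPrime_nonneg hp hq hx)]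

lemma integrable_betaPrimeMeasure_iff {p q : ℝ} (hp : 0 < p) (hq : 0 < q) (f : ℝ → ℂ) :
    Integrable f (betaPrimeMeasure p q) ↔ IntegrableOn
      (fun x : ℝ => (x ^ (p - 1) * (1 + x) ^ (-(p + q)) / betaFun p q) • f x) (Ioi 0) := by
  rw [betaPrimeMeasure_eq_withDensity_restrict, integrable_withDensity_iff_integrable_smul'
    (by fun_prop) (ae_of_all _ fun x => ENNReal.ofReal_lt_top)]
  refine integrable_congr (ae_restrict_of_forall_mem measurableSet_Ioi fun x hx => ?_)
  simp only [ENNReal.toReal_ofReal (betaPrime_nonneg hp hq hx)]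

lemma tendsto_one_add_mul_inv_sub_ofReal {z : ℂ} (hz : 0 < z.im) :
    Tendsto (fun x : ℝ => (1 + (x : ℂ)) * (z - (x : ℂ))⁻¹) atTop (𝓝 (-1)) := by
  have h1 : Tendsto (fun x : ℝ => z - (x : ℂ)) atTop (Bornology.cobounded ℂ) := by
    rw [← tendsto_norm_atTop_iff_cobounded]
    refine tendsto_atTop_mono (fun x => ?_) (tendsto_atTop_add_const_right _ (-‖z‖) tendsto_id)
    have h := norm_sub_norm_le (x : ℂ) z
    rw [norm_sub_rev, Complex.norm_real] at h
    simp only [id]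
    linarith [Real.le_norm_self x]
  have h2 := ((tendsto_inv₀_cobounded.comp h1).const_mul (1 + z)).sub_const 1
  rw [mul_zero, zero_sub] at h2
  refine h2.congr fun x => ?_
  have := sub_ofReal_ne_zero hz x
  simp only [Function.comp]
  field_simp
  ring

lemma tendsto_rpow_mul_one_add_rpow_neg {p q : ℝ} (hp : 0 < p) (hq : 0 < q) :
    Tendsto (fun x : ℝ => x ^ p * (1 + x) ^ (-(p + q))) atTop (𝓝 0) := by
  refine squeeze_zero' ?_ ?_ ((tendsto_rpow_neg_atTop hq).comp
    (tendsto_atTop_add_const_left _ (1 : ℝ) tendsto_id))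
  · filter_upwards [eventually_ge_atTop 0] with x hx
    positivity
  · filter_upwards [eventually_ge_atTop 0] with x hx
    have h1 : 0 < 1 + x := by linarith
    simp only [Function.comp, id]
    calc x ^ p * (1 + x) ^ (-(p + q)) ≤ (1 + x) ^ p * (1 + x) ^ (-(p + q)) := by
          gcongr
          linarith
      _ = (1 + x) ^ (-q) := by
          rw [← Real.rpow_add h1]
          congr 1
          ring

lemma rpow_one_sub {y : ℝ} (hy : 0 < y) (a : ℝ) : y ^ (1 - a) = y * y ^ (-a) := by
  rw [sub_eq_add_neg, Real.rpow_add hy, Real.rpow_one]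

lemma rpow_eq_rpow_sub_one_mul {y : ℝ} (hy : 0 < y) (a : ℝ) : y ^ a = y ^ (a - 1) * y := by
  rw [Real.rpow_sub_one hy.ne', div_mul_cancel₀ _ hy.ne']

lemma hasDerivAt_rpow_mul_one_add_rpow (p q : ℝ) {x : ℝ} (hx : 0 < x) :
    HasDerivAt (fun x : ℝ => x ^ p * (1 + x) ^ (1 - (p + q)))
      (x ^ (p - 1) * (1 + x) ^ (-(p + q)) * (p + (1 - q) * x)) x := by
  have h1 : 0 < 1 + x := by linarith
  have h := (Real.hasDerivAt_rpow_const (p := p) (Or.inl hx.ne')).mul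
    (((hasDerivAt_id x).const_add 1).rpow_const (p := 1 - (p + q)) (Or.inl h1.ne'))
  convert! h using 1
  simp only [id]
  have e1 := rpow_one_sub h1 (p + q)
  have e2 := rpow_eq_rpow_sub_one_mul hx p
  have e3 : 1 - (p + q) - 1 = -(p + q) := by ring
  rw [e3, e1, e2]
  ring

/-- Integration by parts against the beta prime density: the derivative of
`x ^ p * (1 + x) ^ (1 - p - q) / (z - x)` has vanishing integral. -/
lemma integral_betaPrimeMeasure_eq_zero {p q : ℝ} (hp : 0 < p) (hq : 0 < q) {z : ℂ}
    (hz : 0 < z.im) :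
    ∫ x : ℝ, (z * (z + 1) * ((z - (x : ℂ))⁻¹) ^ 2
      + ((p : ℂ) - 1 - (1 + q) * z) * (z - (x : ℂ))⁻¹ + q) ∂betaPrimeMeasure p q = 0 := by
  have := isProbabilityMeasure_betaPrimeMeasure hp hq
  have hint : Integrable (fun x : ℝ => z * (z + 1) * ((z - (x : ℂ))⁻¹) ^ 2
      + ((p : ℂ) - 1 - (1 + q) * z) * (z - (x : ℂ))⁻¹ + q) (betaPrimeMeasure p q) := by
    refine (((integrable_inv_sub_ofReal_pow _ hz 2).const_mul _).add
      (Integrable.const_mul ?_ _)).add (integrable_const _)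
    simpa using integrable_inv_sub_ofReal_pow (betaPrimeMeasure p q) hz 1
  rw [integrable_betaPrimeMeasure_iff hp hq] at hint
  rw [integral_betaPrimeMeasure hp hq]
  have hB : (betaFun p q : ℂ) ≠ 0 := ofReal_ne_zero.2 (betaFun_pos hp hq).ne'
  have key := integral_Ioi_of_hasDerivAt_of_tendsto (a := 0) (m := (0 : ℂ))
    (f := fun x : ℝ => ((x ^ p * (1 + x) ^ (1 - (p + q)) : ℝ) : ℂ) / betaFun p q
      * (z - (x : ℂ))⁻¹) ?_ ?_ hint ?_
  · rw [key]
    simp [Real.zero_rpow hp.ne']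
  · refine ContinuousAt.continuousWithinAt ?_
    refine ContinuousAt.mul (ContinuousAt.div_const ?_ _)
      (ContinuousAt.inv₀ (by fun_prop) (sub_ofReal_ne_zero hz 0))
    refine Complex.continuous_ofReal.continuousAt.comp ?_
    exact (Real.continuousAt_rpow_const _ _ (Or.inr hp.le)).mul
      (ContinuousAt.rpow_const (by fun_prop) (Or.inl (by norm_num)))
  · intro x hx
    have hx' : 0 < x := hx
    have hne := sub_ofReal_ne_zero hz x
    have h1 : 0 < 1 + x := by linarith
    have hd := ((hasDerivAt_rpow_mul_one_add_rpow p q hx').ofReal_comp.div_const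
      (betaFun p q : ℂ)).mul ((((hasDerivAt_id x).ofReal_comp).const_sub z).inv hne)
    convert! hd using 1
    have e1 := rpow_one_sub h1 (p + q)
    have e2 := rpow_eq_rpow_sub_one_mul hx' p
    rw [e1, e2, Complex.real_smul]
    simp only [id, Pi.inv_apply]
    push_cast
    field_simp
    ring
  · have h := ((Complex.continuous_ofReal.tendsto 0).comp
      (tendsto_rpow_mul_one_add_rpow_neg hp hq)).div_const (betaFun p q : ℂ) |>.mul
      (tendsto_one_add_mul_inv_sub_ofReal hz)
    rw [ofReal_zero, zero_div, zero_mul] at h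
    refine h.congr' ?_
    filter_upwards [eventually_gt_atTop 0] with x hx
    have h1 : 0 < 1 + x := by linarith
    have e1 := rpow_one_sub h1 (p + q)
    simp only [Function.comp, e1]
    push_cast
    ring

theorem stmt_10 (p q : ℝ) (hp : 0 < p) (hq : 0 < q)
    (z : ℂ) (hz : 0 < z.im) :
    HasDerivAt (cauchyT (betaPrimeMeasure p q))
      ((((p : ℂ) - 1) / z - ((p : ℂ) + (q : ℂ)) / (z + 1)) * cauchyT (betaPrimeMeasure p q) z
        + (q : ℂ) / (z * (z + 1))) z := by
  have := isProbabilityMeasure_betaPrimeMeasure hp hq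
  have hz0 : z ≠ 0 := by simpa using sub_ofReal_ne_zero hz 0
  have hz1 : z + 1 ≠ 0 := by simpa using sub_ofReal_ne_zero hz (-1)
  have i2 := integrable_inv_sub_ofReal_pow (betaPrimeMeasure p q) hz 2
  have i1 : Integrable (fun x : ℝ => (z - (x : ℂ))⁻¹) (betaPrimeMeasure p q) := by
    simpa using integrable_inv_sub_ofReal_pow (betaPrimeMeasure p q) hz 1
  have key := integral_betaPrimeMeasure_eq_zero hp hq hz
  rw [integral_add (by fun_prop) (integrable_const _),
    integral_add (i2.const_mul _) (i1.const_mul _), integral_const_mul, integral_const_mul,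
    integral_const, probReal_univ, one_smul] at key
  convert! hasDerivAt_cauchyT (betaPrimeMeasure p q) hz using 1
  rw [integral_neg]
  unfold cauchyT
  generalize ∫ x : ℝ, (z - (x : ℂ))⁻¹ ∂betaPrimeMeasure p q = G at key ⊢
  generalize ∫ x : ℝ, ((z - (x : ℂ))⁻¹) ^ 2 ∂betaPrimeMeasure p q = D at key ⊢
  field_simp
  linear_combination key
end

section
/- Let q > 1/2 and let t_q be the Student t-distribution. There exists a function f analytic on the domain D^{st} := (ℂ⁻ ∪ ℍ⁺)∖{iy : y ∈ [−1,0]}, where ℂ⁻ = {Im z < 0} and ℍ⁺ = {Re z > 0}, such that f(z) = G_{t_q}(z) for all z ∈ ℂ⁺ = {Im z > 0}, and such that for all z in the open fourth quadrant {Re z > 0, Im z < 0} one has f(z) = G̃_{t_q}(z) − (2πi/B(1/2, q−1/2))·(1+z²)^{−q}, where (1+z²)^{−q} is the principal branch (well defined since 1+z² ∈ ℂ∖[0,∞)... in fact Im(1+z²) < 0 there). -/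
open MeasureTheory Complex Set

/-- The Student t-distribution `t_q` on ℝ, with density `(1+x²)^(-q)/B(1/2, q-1/2)`. -/
noncomputable def tMeasure (q : ℝ) : Measure ℝ :=
  volume.withDensity fun x =>
    ENNReal.ofReal ((1 + x ^ 2) ^ (-q) / betaFun (1/2) (q - 1/2))

/-- The domain `D^{st} = (ℂ⁻ ∪ ℍ⁺) ∖ i[-1,0]`. -/
def studentDomain : Set ℂ :=
  {z : ℂ | z.im < 0 ∨ 0 < z.re} \ {z : ℂ | z.re = 0 ∧ z.im ∈ Icc (-1 : ℝ) 0}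

open Filter Topology

/-- A dominated integral of holomorphic functions is holomorphic. -/
theorem differentiableOn_integral_of_dominated {α : Type*} [MeasurableSpace α] {μ : Measure α}
    {U : Set ℂ} (hU : IsOpen U) {F : ℂ → α → ℂ} {bound : α → ℝ}
    (hmeas : ∀ z ∈ U, AEStronglyMeasurable (F z) μ)
    (hbound : ∀ᵐ x ∂μ, ∀ z ∈ U, ‖F z x‖ ≤ bound x) (hint : Integrable bound μ)
    (hdiff : ∀ᵐ x ∂μ, DifferentiableOn ℂ (fun z => F z x) U) :
    DifferentiableOn ℂ (fun z => ∫ x, F z x ∂μ) U := by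
  intro z₀ hz₀
  obtain ⟨r, hr, hrU⟩ := Metric.isOpen_iff.1 hU z₀ hz₀
  have hderiv : ∀ᵐ x ∂μ, ∀ z ∈ Metric.ball z₀ (r / 2),
      HasDerivAt (fun z => F z x) (deriv (fun z => F z x) z) z := by
    filter_upwards [hdiff] with x hx z hz
    have hzU : z ∈ U := hrU (Metric.ball_subset_ball (by linarith) hz)
    exact ((hx z hzU).differentiableAt (hU.mem_nhds hzU)).hasDerivAt
  refine (hasDerivAt_integral_of_dominated_loc_of_deriv_le
    (F' := fun z x => deriv (fun z => F z x) z) (bound := fun x => bound x / (r / 4))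
    (Metric.ball_mem_nhds z₀ (half_pos hr)) ?_ ?_ ?_ ?_ ?_ hderiv).2.differentiableAt
      |>.differentiableWithinAt
  · filter_upwards [hU.mem_nhds hz₀] with z hz using hmeas z hz
  · refine hint.mono' (hmeas z₀ hz₀) ?_
    filter_upwards [hbound] with x hx using hx z₀ hz₀
  · obtain ⟨u, hu, hu0⟩ : ∃ u : ℕ → ℂ, (∀ n, z₀ + u n ∈ U) ∧ Tendsto u atTop (𝓝[≠] 0) := by
      have hcont : Tendsto (fun w : ℂ => z₀ + w) (𝓝[≠] 0) (𝓝 z₀) := by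
        have : ContinuousAt (fun w : ℂ => z₀ + w) 0 := by fun_prop
        simpa [ContinuousAt] using this.mono_left nhdsWithin_le_nhds
      obtain ⟨u, hu⟩ := exists_seq_tendsto (𝓝[≠] (0 : ℂ))
      obtain ⟨N, hN⟩ := eventually_atTop.1 ((hcont.comp hu).eventually (hU.mem_nhds hz₀))
      exact ⟨fun n => u (n + N), fun n => hN _ (by omega),
        (tendsto_add_atTop_iff_nat N).2 hu⟩
    refine aestronglyMeasurable_of_tendsto_ae (u := atTop)
      (f := fun n x => (u n)⁻¹ • (F (z₀ + u n) x - F z₀ x))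
      (fun n => ((hmeas _ (hu n)).sub (hmeas z₀ hz₀)).const_smul (u n)⁻¹) ?_
    filter_upwards [hderiv] with x hx
    exact (hx z₀ (Metric.mem_ball_self (half_pos hr))).tendsto_slope_zero.comp hu0
  · filter_upwards [hdiff, hbound] with x hx hb z hz
    have hsub : Metric.closedBall z (r / 4) ⊆ U := fun w hw => hrU <| by
      rw [Metric.mem_ball] at *
      rw [Metric.mem_closedBall] at hw
      linarith [dist_triangle w z z₀]
    refine Complex.norm_deriv_le_of_forall_mem_sphere_norm_le (by positivity) ?_
      (fun w hw => hb w (hsub (Metric.sphere_subset_closedBall hw)))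
    exact (hx.mono ((closure_ball z (by positivity)).le.trans hsub)).diffContOnCl
  · exact hint.div_const _

theorem norm_dslope_le_of_norm_deriv_le {R : ℂ → ℂ} {s : Set ℂ} (hs : Convex ℝ s) {M : ℝ}
    (hd : ∀ z ∈ s, DifferentiableAt ℂ R z) (hM : ∀ z ∈ s, ‖deriv R z‖ ≤ M)
    {w z : ℂ} (hw : w ∈ s) (hz : z ∈ s) : ‖dslope R w z‖ ≤ M := by
  rcases eq_or_ne z w with rfl | h
  · rw [dslope_same]
    exact hM z hz
  · rw [dslope_of_ne _ h, slope_def_field, norm_div, div_le_iff₀ (norm_pos_iff.2 (sub_ne_zero.2 h))]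
    exact hs.norm_image_sub_le_of_norm_deriv_le hd hM hw hz

theorem dslope_swap (R : ℂ → ℂ) (w z : ℂ) : dslope R w z = dslope R z w := by
  rcases eq_or_ne z w with rfl | h
  · rfl
  · rw [dslope_of_ne _ h, dslope_of_ne _ h.symm, slope_comm]

/-- The primitive of the Cauchy kernel on a segment. -/
theorem intervalIntegral_inv_sub_ofReal {z : ℂ} (hz : z.im ≠ 0) (b c : ℝ) :
    ∫ x in b..c, (z - (x : ℂ))⁻¹ = log (z - b) - log (z - c) := by
  have hne : ∀ x : ℝ, z - (x : ℂ) ∈ slitPlane := fun x => Or.inr (by simpa using hz)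
  have hcont : Continuous fun x : ℝ => (z - (x : ℂ))⁻¹ :=
    (by fun_prop : Continuous fun x : ℝ => z - (x : ℂ)).inv₀ fun x => slitPlane_ne_zero (hne x)
  rw [intervalIntegral.integral_eq_sub_of_hasDerivAt (f := fun x : ℝ => -log (z - (x : ℂ)))
    (fun x _ => ?_) (hcont.intervalIntegrable _ _)]
  · ring
  · have h := (((hasDerivAt_id x).ofReal_comp.const_sub z).clog_real (hne x)).neg
    simpa [neg_div, one_div, Pi.neg_def] using h

theorem log_sub_of_im_pos {z : ℂ} (hz : 0 < z.im) (c : ℝ) :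
    log (z - c) = log (c - z) + Real.pi * I := by
  have h := arg_neg_eq_arg_sub_pi_of_im_pos (x := z - c) (by simpa using hz)
  rw [neg_sub] at h
  simp only [log, h, norm_sub_rev z]
  push_cast
  ring

theorem log_sub_of_im_neg {z : ℂ} (hz : z.im < 0) (c : ℝ) :
    log (z - c) = log (c - z) - Real.pi * I := by
  have h := arg_neg_eq_arg_add_pi_of_im_neg (x := z - c) (by simpa using hz)
  rw [neg_sub] at h
  simp only [log, h, norm_sub_rev z]
  push_cast
  ring

/-- Cauchy transforms are holomorphic at positive distance from the support. -/
theorem differentiableOn_integral_mul_inv_sub {ρ : ℝ → ℂ} {s : Set ℝ} (hs : MeasurableSet s)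
    (hρ : IntegrableOn ρ s) {U : Set ℂ} (hU : IsOpen U) {ε : ℝ} (hε : 0 < ε)
    (hd : ∀ z ∈ U, ∀ x ∈ s, ε ≤ ‖z - (x : ℂ)‖) :
    DifferentiableOn ℂ (fun z => ∫ x in s, ρ x * (z - (x : ℂ))⁻¹) U := by
  refine differentiableOn_integral_of_dominated hU (bound := fun x => ‖ρ x‖ * ε⁻¹)
    (fun z _ => hρ.aestronglyMeasurable.mul (by fun_prop)) ?_ (hρ.norm.mul_const _) ?_
  · filter_upwards [ae_restrict_mem hs] with x hx z hz
    rw [norm_mul, norm_inv]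
    gcongr
    exact hd z hz x hx
  · filter_upwards [ae_restrict_mem hs] with x hx z hz
    have : z - (x : ℂ) ≠ 0 := norm_pos_iff.1 (hε.trans_le (hd z hz x hx))
    fun_prop (disch := assumption)

theorem abs_im_le_norm_sub_ofReal {z : ℂ} (x : ℝ) : |z.im| ≤ ‖z - (x : ℂ)‖ := by
  simpa using abs_im_le_norm (z - (x : ℂ))

theorem integrable_mul_inv_sub {ρ : ℝ → ℂ} (hρ : Integrable ρ) {z : ℂ} (hz : z.im ≠ 0) :
    Integrable fun x : ℝ => ρ x * (z - (x : ℂ))⁻¹ := by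
  refine hρ.mul_bdd (c := |z.im|⁻¹) (by fun_prop) (Eventually.of_forall fun x => ?_)
  rw [norm_inv]
  gcongr
  exact abs_im_le_norm_sub_ofReal x

/-- Analytic continuation of a Cauchy transform across a point where the density is analytic. -/
theorem exists_analyticAt_cauchy_continuation {ρ : ℝ → ℂ} (hρ : Integrable ρ) {R : ℂ → ℂ} {a : ℝ}
    (hR : AnalyticAt ℂ R a) (hRρ : ∀ᶠ x : ℝ in 𝓝 a, ρ x = R x) :
    ∃ Φ : ℂ → ℂ, AnalyticAt ℂ Φ a ∧
      (∀ᶠ z in 𝓝 (a : ℂ), 0 < z.im → (∫ x, ρ x * (z - (x : ℂ))⁻¹) = Φ z) ∧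
      (∀ᶠ z in 𝓝 (a : ℂ), z.im < 0 →
        (∫ x, ρ x * (z - (x : ℂ))⁻¹) - 2 * Real.pi * I * R z = Φ z) := by
  obtain ⟨M, hM⟩ := exists_gt ‖deriv R a‖
  obtain ⟨δ₁, hδ₁, h₁⟩ := Metric.eventually_nhds_iff_ball.1
    (hR.eventually_analyticAt.and
      (hR.deriv.continuousAt.norm.eventually (gt_mem_nhds hM)))
  obtain ⟨δ₂, hδ₂, h₂⟩ := Metric.eventually_nhds_iff_ball.1 hRρ
  obtain ⟨δ, hδ, hδ₁', hδ₂'⟩ : ∃ δ > 0, δ ≤ δ₁ ∧ δ ≤ δ₂ :=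
    ⟨min δ₁ δ₂, lt_min hδ₁ hδ₂, min_le_left _ _, min_le_right _ _⟩
  set B : Set ℂ := Metric.ball (a : ℂ) δ
  set U : Set ℂ := Metric.ball (a : ℂ) (δ / 2)
  set s : Set ℝ := Ioc (a - δ / 2) (a + δ / 2)
  have hBd : ∀ z ∈ B, DifferentiableAt ℂ R z := fun z hz =>
    (h₁ z (Metric.ball_subset_ball hδ₁' hz)).1.differentiableAt
  have hBM : ∀ z ∈ B, ‖deriv R z‖ ≤ M := fun z hz =>
    (h₁ z (Metric.ball_subset_ball hδ₁' hz)).2.le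
  have hB : IsOpen B := Metric.isOpen_ball
  have hUB : U ⊆ B := Metric.ball_subset_ball (by linarith)
  have hs : MeasurableSet s := measurableSet_Ioc
  have hsB : ∀ x ∈ s, (x : ℂ) ∈ B := fun x hx => by
    rw [Metric.mem_ball, Complex.dist_eq, ← ofReal_sub, norm_real, Real.norm_eq_abs, abs_lt]
    constructor <;> linarith [hx.1, hx.2]
  have hsρ : ∀ x ∈ s, ρ x = R x := fun x hx => h₂ x <| by
    rw [Metric.mem_ball, Real.dist_eq, abs_lt]
    constructor <;> linarith [hx.1, hx.2]
  have hre : ∀ z ∈ U, |z.re - a| < δ / 2 := fun z hz => by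
    refine lt_of_le_of_lt ?_ (mem_ball_iff_norm.1 hz)
    simpa using abs_re_le_norm (z - a)
  have hds : ∀ z ∈ B, DifferentiableOn ℂ (dslope R z) B := fun z hz =>
    (differentiableOn_dslope (hB.mem_nhds hz)).2 fun w hw => (hBd w hw).differentiableWithinAt
  have hmeas : ∀ z ∈ B, AEStronglyMeasurable (fun x : ℝ => dslope R (x : ℂ) z)
      (volume.restrict s) := fun z hz => by
    simp_rw [fun x : ℝ => dslope_swap R (x : ℂ) z]
    exact ((hds z hz).continuousOn.comp continuous_ofReal.continuousOn hsB).aestronglyMeasurable hs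
  have hbdd : ∀ᵐ x : ℝ ∂volume.restrict s, ∀ z ∈ B, ‖dslope R (x : ℂ) z‖ ≤ M := by
    filter_upwards [ae_restrict_mem hs] with x hx z hz
    exact norm_dslope_le_of_norm_deriv_le (convex_ball _ _) hBd hBM (hsB x hx) hz
  have hconst : Integrable (fun _ : ℝ => M) (volume.restrict s) := by
    exact integrableOn_const (by simp [s])
  have hD : DifferentiableOn ℂ (fun z => ∫ x in s, dslope R (x : ℂ) z) B := by
    refine differentiableOn_integral_of_dominated hB hmeas hbdd hconst ?_
    filter_upwards [ae_restrict_mem hs] with x hx using hds x (hsB x hx)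
  set U' : Set ℂ := Metric.ball (a : ℂ) (δ / 4)
  have hU' : U' ∈ 𝓝 (a : ℂ) := Metric.ball_mem_nhds _ (by positivity)
  have hUU' : U' ⊆ U := Metric.ball_subset_ball (by linarith)
  have hE : DifferentiableOn ℂ (fun z => ∫ x in sᶜ, ρ x * (z - (x : ℂ))⁻¹) U' := by
    refine differentiableOn_integral_mul_inv_sub hs.compl hρ.integrableOn Metric.isOpen_ball
      (ε := δ / 4) (by positivity) fun z hz x hx => ?_
    have h1 : ‖z - (a : ℂ)‖ < δ / 4 := mem_ball_iff_norm.1 hz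
    have h2 : δ / 2 ≤ ‖(x : ℂ) - a‖ := by
      rw [← ofReal_sub, norm_real, Real.norm_eq_abs]
      by_contra! h
      rw [abs_lt] at h
      exact hx ⟨by linarith [h.1], by linarith [h.2]⟩
    have h3 := norm_sub_norm_le ((x : ℂ) - a) (z - a)
    rw [sub_sub_sub_cancel_right, norm_sub_rev (x : ℂ) z] at h3
    linarith
  have hlog₁ : ∀ z ∈ U, z - ((a - δ / 2 : ℝ) : ℂ) ∈ slitPlane := fun z hz =>
    Or.inl (by simp only [sub_re, ofReal_re]; linarith [(abs_lt.1 (hre z hz)).1])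
  have hlog₂ : ∀ z ∈ U, ((a + δ / 2 : ℝ) : ℂ) - z ∈ slitPlane := fun z hz =>
    Or.inl (by simp only [sub_re, ofReal_re]; linarith [(abs_lt.1 (hre z hz)).2])
  have key : ∀ z ∈ U', z.im ≠ 0 → ∫ x, ρ x * (z - (x : ℂ))⁻¹ =
      (∫ x in sᶜ, ρ x * (z - (x : ℂ))⁻¹) - (∫ x in s, dslope R (x : ℂ) z)
        + R z * (log (z - ((a - δ / 2 : ℝ) : ℂ)) - log (z - ((a + δ / 2 : ℝ) : ℂ))) := by
    intro z hz him
    have hzB : z ∈ B := hUB (hUU' hz)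
    have hne : ∀ x : ℝ, z ≠ x := fun x h => him (by simp [h])
    have hint : IntegrableOn (fun x : ℝ => (z - (x : ℂ))⁻¹) s := by
      have hc : Continuous fun x : ℝ => (z - (x : ℂ))⁻¹ :=
        (by fun_prop : Continuous fun x : ℝ => z - (x : ℂ)).inv₀ fun x => sub_ne_zero.2 (hne x)
      exact hc.integrableOn_Ioc
    have hint' : IntegrableOn (fun x : ℝ => dslope R (x : ℂ) z) s :=
      hconst.mono' (hmeas z hzB) (hbdd.mono fun x hx => hx z hzB)
    rw [← integral_add_compl hs (integrable_mul_inv_sub hρ him),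
      ← intervalIntegral_inv_sub_ofReal him, intervalIntegral.integral_of_le (by linarith),
      ← integral_const_mul]
    have : ∫ x in s, ρ x * (z - (x : ℂ))⁻¹ =
        ∫ x in s, (R z * (z - (x : ℂ))⁻¹ - dslope R (x : ℂ) z) := by
      refine setIntegral_congr_fun hs fun x hx => ?_
      have := sub_ne_zero.2 (hne x)
      rw [hsρ x hx, dslope_of_ne _ (hne x), slope_def_field]
      field_simp
      ring
    rw [this, integral_sub (hint.const_mul _) hint']
    ring
  refine ⟨fun z => (∫ x in sᶜ, ρ x * (z - (x : ℂ))⁻¹) - (∫ x in s, dslope R (x : ℂ) z)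
        + R z * (log (z - ((a - δ / 2 : ℝ) : ℂ)) - log (((a + δ / 2 : ℝ) : ℂ) - z)
          - Real.pi * I), ?_, ?_, ?_⟩
  · refine DifferentiableOn.analyticAt (s := U') ?_ hU'
    refine (hE.sub (hD.mono (hUU'.trans hUB))).add ?_
    intro z hz
    have h1 := hlog₁ z (hUU' hz)
    have h2 := hlog₂ z (hUU' hz)
    have h3 := hBd z (hUB (hUU' hz))
    refine DifferentiableAt.differentiableWithinAt (h3.mul ?_)
    exact (((differentiableAt_id.sub_const _).clog h1).sub
      ((differentiableAt_id.const_sub _).clog h2)).sub_const _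
  · filter_upwards [hU'] with z hz him
    rw [key z hz him.ne', log_sub_of_im_pos him (a + δ / 2)]
    ring
  · filter_upwards [hU'] with z hz him
    rw [key z hz him.ne, log_sub_of_im_neg him (a + δ / 2)]
    ring

/-- The branch of `log (1 + z ^ 2)` on the lower half-plane slit along `i[-1,0]` which is principal
in the fourth quadrant. -/
noncomputable def studentLog (z : ℂ) : ℂ := log (I * z - 1) + log (I * z + 1) - Real.pi * I

theorem differentiableAt_studentLog {z : ℂ} (hz : z.im < 0) (hz' : z.re ≠ 0 ∨ z.im < -1) :
    DifferentiableAt ℂ studentLog z := by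
  have h1 : I * z - 1 ∈ slitPlane := by
    rcases hz' with h | h
    · exact Or.inr (by simpa using h)
    · exact Or.inl (by simp; linarith)
  have h2 : I * z + 1 ∈ slitPlane := Or.inl (by simp; linarith)
  unfold studentLog
  exact (((by fun_prop : DifferentiableAt ℂ (fun z => I * z - 1) z).clog h1).add
    ((by fun_prop : DifferentiableAt ℂ (fun z => I * z + 1) z).clog h2)).sub_const _

theorem exp_studentLog {z : ℂ} (hz : z.im < 0) (hz' : z.re ≠ 0 ∨ z.im < -1) :
    exp (studentLog z) = 1 + z ^ 2 := by
  have h1 : I * z - 1 ≠ 0 := fun h => by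
    have hre := congrArg re h
    have him := congrArg im h
    simp at hre him
    rcases hz' with h | h
    · exact h him
    · linarith
  have h2 : I * z + 1 ≠ 0 := fun h => by
    have hre := congrArg re h
    simp at hre
    linarith
  rw [studentLog, exp_sub, exp_add, exp_log h1, exp_log h2, exp_pi_mul_I]
  linear_combination (-z ^ 2) * I_sq

theorem studentLog_eq_log {z : ℂ} (hre : 0 < z.re) (him : z.im < 0) :
    studentLog z = log (1 + z ^ 2) := by
  rw [← exp_studentLog him (Or.inl hre.ne'), log_exp]
  all_goals
    have h1 : 0 ≤ arg (I * z - 1) := arg_nonneg_iff.2 (by simpa using hre.le)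
    have h2 : 0 ≤ arg (I * z + 1) := arg_nonneg_iff.2 (by simpa using hre.le)
    have h3 : arg (I * z + 1) ≠ 0 := fun h => by
      have := (arg_eq_zero_iff.1 h).2
      simp at this
      exact hre.ne' this
    have h4 := arg_le_pi (I * z - 1)
    have h5 := arg_le_pi (I * z + 1)
    simp [studentLog, log_im]
  · positivity
  · linarith

theorem exp_studentLog_eq_cpow (q : ℂ) {z : ℂ} (hre : 0 < z.re) (him : z.im < 0) :
    exp (q * studentLog z) = (1 + z ^ 2) ^ q := by
  have h : 1 + z ^ 2 ≠ 0 := exp_studentLog him (Or.inl hre.ne') ▸ exp_ne_zero _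
  rw [cpow_def_of_ne_zero h, studentLog_eq_log hre him, mul_comm]

theorem betaFun_nonneg (p q : ℝ) : 0 ≤ betaFun p q :=
  setIntegral_nonneg measurableSet_Ioo fun _ hx =>
    mul_nonneg (Real.rpow_nonneg hx.1.le _) (Real.rpow_nonneg (sub_nonneg.2 hx.2.le) _)

/-- The density of the Student t-distribution. -/
noncomputable def studentDensity (q x : ℝ) : ℝ := (1 + x ^ 2) ^ (-q) / betaFun (1/2) (q - 1/2)

theorem cauchyT_tMeasure (q : ℝ) (z : ℂ) :
    cauchyT (tMeasure q) z = ∫ x, (studentDensity q x : ℂ) * (z - (x : ℂ))⁻¹ := by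
  have hnn : ∀ x : ℝ, 0 ≤ (1 + x ^ 2) ^ (-q) / betaFun (1/2) (q - 1/2) := fun _ =>
    div_nonneg (by positivity) (betaFun_nonneg _ _)
  rw [cauchyT, tMeasure, integral_withDensity_eq_integral_toReal_smul (by fun_prop) (by simp)]
  refine integral_congr_ae (Eventually.of_forall fun x => ?_)
  simp only [ENNReal.toReal_ofReal (hnn x), Complex.real_smul, studentDensity]

theorem integrable_studentDensity {q : ℝ} (hq : 1/2 < q) :
    Integrable fun x => (studentDensity q x : ℂ) := by
  have h := integrable_rpow_neg_one_add_norm_sq (E := ℝ) (μ := volume) (r := 2 * q)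
    (by simp; linarith)
  refine Integrable.ofReal ?_
  refine (h.div_const (betaFun (1/2) (q - 1/2))).congr (Eventually.of_forall fun x => ?_)
  simp only [Real.norm_eq_abs, sq_abs]
  congr 2
  ring

theorem differentiableAt_cauchyT_tMeasure {q : ℝ} (hq : 1/2 < q) {z : ℂ} (hz : z.im ≠ 0) :
    DifferentiableAt ℂ (cauchyT (tMeasure q)) z := by
  have hU : IsOpen {w : ℂ | |z.im| / 2 < |w.im|} :=
    isOpen_lt continuous_const (continuous_abs.comp continuous_im)
  have hz' : 0 < |z.im| := abs_pos.2 hz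
  have h := differentiableOn_integral_mul_inv_sub MeasurableSet.univ
    (integrable_studentDensity hq).integrableOn hU (half_pos hz')
    fun w hw x _ => (le_of_lt hw).trans (abs_im_le_norm_sub_ofReal x)
  simp only [Measure.restrict_univ, ← cauchyT_tMeasure] at h
  exact (h z (half_lt_self hz')).differentiableAt (hU.mem_nhds (half_lt_self hz'))

/-- The value off the real axis of the continuation of the Cauchy transform. -/
noncomputable def studentContOff (q : ℝ) (z : ℂ) : ℂ :=
  if 0 < z.im then cauchyT (tMeasure q) z
  else cauchyT (tMeasure q) z - (2 * (Real.pi : ℂ) * I / ((betaFun (1/2) (q - 1/2) : ℝ) : ℂ))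
    * exp (-(q : ℂ) * studentLog z)

/-- The continuation of the Cauchy transform, extended to the real axis by limits. -/
noncomputable def studentCont (q : ℝ) (z : ℂ) : ℂ :=
  if z.im = 0 then limUnder (𝓝[{w | w.im ≠ 0}] z) (studentContOff q) else studentContOff q z

theorem exists_analyticAt_studentContOff {q : ℝ} (hq : 1/2 < q) {a : ℝ} (ha : 0 < a) :
    ∃ Φ : ℂ → ℂ, AnalyticAt ℂ Φ a ∧
      ∀ᶠ z in 𝓝 (a : ℂ), z.im ≠ 0 → studentContOff q z = Φ z := by
  have hR : AnalyticAt ℂ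
      (fun z : ℂ => (1 + z ^ 2) ^ (-(q : ℂ)) / ((betaFun (1/2) (q - 1/2) : ℝ) : ℂ)) a := by
    have h : 1 + (a : ℂ) ^ 2 ∈ slitPlane := by
      refine Or.inl ?_
      rw [← ofReal_pow, add_re, ofReal_re, one_re]
      positivity
    have h' : AnalyticAt ℂ (fun z : ℂ => 1 + z ^ 2) a := by fun_prop
    exact (h'.cpow analyticAt_const h).div_const
  obtain ⟨Φ, hΦ, h1, h2⟩ := exists_analyticAt_cauchy_continuation
    (integrable_studentDensity hq) hR (Eventually.of_forall fun _ => by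
      rw [studentDensity, ofReal_div, ofReal_cpow (by positivity)]
      push_cast
      rfl)
  have hre : ∀ᶠ z in 𝓝 (a : ℂ), 0 < z.re :=
    continuous_re.continuousAt.eventually (lt_mem_nhds (by simpa using ha))
  refine ⟨Φ, hΦ, ?_⟩
  filter_upwards [h1, h2, hre] with z h1 h2 hre him
  rcases him.lt_or_gt with him | him
  · rw [← h2 him, studentContOff, if_neg him.not_gt, exp_studentLog_eq_cpow _ hre him,
      cauchyT_tMeasure]
    ring
  · rw [← h1 him, studentContOff, if_pos him, cauchyT_tMeasure]

theorem nhdsWithin_im_ne_zero_neBot (z : ℂ) : (𝓝[{w : ℂ | w.im ≠ 0}] z).NeBot := by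
  have : Dense {w : ℂ | w.im ≠ 0} := (dense_compl_singleton (0 : ℝ)).preimage isOpenMap_im
  exact mem_closure_iff_nhdsWithin_neBot.1 (this z)

theorem analyticAt_studentCont_ofReal {q : ℝ} (hq : 1/2 < q) {a : ℝ} (ha : 0 < a) :
    AnalyticAt ℂ (studentCont q) a := by
  obtain ⟨Φ, hΦ, h⟩ := exists_analyticAt_studentContOff hq ha
  refine hΦ.congr ?_
  filter_upwards [hΦ.eventually_analyticAt, h.eventually_nhds] with z hz h
  unfold studentCont
  split_ifs with him
  · have := nhdsWithin_im_ne_zero_neBot z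
    refine (Tendsto.limUnder_eq ?_).symm
    refine (hz.continuousAt.tendsto.mono_left nhdsWithin_le_nhds).congr' ?_
    filter_upwards [nhdsWithin_le_nhds h, self_mem_nhdsWithin] with w hw hw' using (hw hw').symm
  · exact (h.self_of_nhds him).symm

theorem studentCont_of_im_pos (q : ℝ) {z : ℂ} (hz : 0 < z.im) :
    studentCont q z = cauchyT (tMeasure q) z := by
  rw [studentCont, if_neg hz.ne', studentContOff, if_pos hz]

theorem studentCont_of_im_neg (q : ℝ) {z : ℂ} (hz : z.im < 0) :
    studentCont q z = cauchyT (tMeasure q) z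
      - (2 * (Real.pi : ℂ) * I / ((betaFun (1/2) (q - 1/2) : ℝ) : ℂ))
        * exp (-(q : ℂ) * studentLog z) := by
  rw [studentCont, if_neg hz.ne, studentContOff, if_neg hz.not_gt]

theorem analyticAt_studentCont_of_im_pos {q : ℝ} (hq : 1/2 < q) {z : ℂ} (hz : 0 < z.im) :
    AnalyticAt ℂ (studentCont q) z := by
  refine DifferentiableOn.analyticAt (s := {w : ℂ | 0 < w.im}) (fun w hw => ?_)
    ((isOpen_lt continuous_const continuous_im).mem_nhds hz)
  exact (differentiableAt_cauchyT_tMeasure hq (ne_of_gt hw)).differentiableWithinAt.congr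
    (fun v hv => studentCont_of_im_pos q hv) (studentCont_of_im_pos q hw)

theorem analyticAt_studentCont_of_im_neg {q : ℝ} (hq : 1/2 < q) {z : ℂ} (hz : z.im < 0)
    (hz' : z.re ≠ 0 ∨ z.im < -1) : AnalyticAt ℂ (studentCont q) z := by
  have hopen : IsOpen {w : ℂ | w.im < 0 ∧ (w.re ≠ 0 ∨ w.im < -1)} :=
    (isOpen_lt continuous_im continuous_const).inter
      ((isOpen_ne_fun continuous_re continuous_const).union
        (isOpen_lt continuous_im continuous_const))
  refine DifferentiableOn.analyticAt (fun w hw => ?_) (hopen.mem_nhds ⟨hz, hz'⟩)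
  have h1 := differentiableAt_cauchyT_tMeasure hq hw.1.ne
  have h2 := differentiableAt_studentLog hw.1 hw.2
  exact (h1.sub ((h2.const_mul _).cexp.const_mul _)).differentiableWithinAt.congr
    (fun v hv => studentCont_of_im_neg q hv.1) (studentCont_of_im_neg q hw.1)

theorem stmt_14 (q : ℝ) (hq : 1/2 < q) :
    ∃ f : ℂ → ℂ, AnalyticOnNhd ℂ f studentDomain ∧
      (∀ z : ℂ, 0 < z.im → f z = cauchyT (tMeasure q) z) ∧
      (∀ z : ℂ, 0 < z.re → z.im < 0 →
        f z = cauchyT (tMeasure q) z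
          - (2 * (Real.pi : ℂ) * Complex.I / ((betaFun (1/2) (q - 1/2) : ℝ) : ℂ))
            * (1 + z ^ 2) ^ (-(q : ℂ))) := by
  refine ⟨studentCont q, ?_, fun z => studentCont_of_im_pos q, fun z hre him => ?_⟩
  · rintro z ⟨hz, hz'⟩
    rcases lt_trichotomy z.im 0 with him | him | him
    · refine analyticAt_studentCont_of_im_neg hq him ?_
      by_contra! h
      exact hz' ⟨h.1, h.2, him.le⟩
    · have hzre : z = (z.re : ℂ) := Complex.ext (by simp) (by simpa using him)
      rw [hzre]
      exact analyticAt_studentCont_ofReal hq (hz.resolve_left him.not_lt)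
    · exact analyticAt_studentCont_of_im_pos hq him
  · rw [studentCont_of_im_neg q him, exp_studentLog_eq_cpow _ hre him]
end
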